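/- arXiv:1001.1499 — 2 statements merged into one kernel-verified Lean document; each statement's English description precedes it below -/
import Mathlib

section
/- For every ε with 0 < ε < 1 the infinite product C := ∏_{n=1}^∞ (1 + α_n η_n'(0)) converges to a strictly positive real number, and there exists ε₀ ∈ (0,1) such that for all ε with 0 < ε < ε₀ one has C < 1; in particular C ≠ 1 for such ε. -/
open Filter Topology

/-- `ε₀ = 0`, `εₙ = ε^(2^n)` for `n ≥ 1`. -/
noncomputable def epsSeq (ε : ℝ) (n : ℕ) : ℝ := if n = 0 then 0 else ε ^ (2 ^ n)

/-- `αₙ = 1 + εₙ`. -/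
noncomputable def alphaSeq (ε : ℝ) (n : ℕ) : ℝ := 1 + epsSeq ε n

/-- `η₀'(η) = η`, `η_{n+1}'(η) = αₙ² ηₙ'(η)² − ε_{n+1}/α_{n+1}`. -/
noncomputable def etaP (ε : ℝ) : ℕ → ℝ → ℝ
  | 0 => fun η => η
  | n + 1 => fun η =>
      alphaSeq ε n ^ 2 * (etaP ε n η) ^ 2 - epsSeq ε (n + 1) / alphaSeq ε (n + 1)

/-- `C = ∏_{n=1}^∞ (1 + αₙ ηₙ'(0))`. -/
noncomputable def Cprod (ε : ℝ) : ℝ :=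
  ∏' n : ℕ, (1 + alphaSeq ε (n + 1) * etaP ε (n + 1) 0)

theorem epsSeq_succ (ε : ℝ) (n : ℕ) : epsSeq ε (n + 1) = ε ^ (2 ^ (n + 1)) := by
  simp [epsSeq]

theorem epsSeq_succ_succ (ε : ℝ) (n : ℕ) : epsSeq ε (n + 2) = epsSeq ε (n + 1) ^ 2 := by
  rw [epsSeq_succ, epsSeq_succ, ← pow_mul, ← pow_succ]

theorem epsSeq_succ_pos {ε : ℝ} (h0 : 0 < ε) (n : ℕ) : 0 < epsSeq ε (n + 1) := by
  rw [epsSeq_succ]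
  positivity

theorem epsSeq_succ_lt_one {ε : ℝ} (h0 : 0 < ε) (h1 : ε < 1) (n : ℕ) : epsSeq ε (n + 1) < 1 := by
  rw [epsSeq_succ]
  exact pow_lt_one₀ h0.le h1 (by positivity)

theorem summable_epsSeq_succ {ε : ℝ} (h0 : 0 < ε) (h1 : ε < 1) :
    Summable fun n => epsSeq ε (n + 1) := by
  refine Summable.of_nonneg_of_le (fun n => (epsSeq_succ_pos h0 n).le) (fun n => ?_)
    (summable_geometric_of_lt_one h0.le h1)
  rw [epsSeq_succ]
  exact pow_le_pow_of_le_one h0.le h1.le ((Nat.le_succ n).trans Nat.lt_two_pow_self.le)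

/-- The recursion satisfied by the products `αₙ ηₙ'`. -/
theorem alphaSeq_mul_etaP_succ {ε : ℝ} (h0 : 0 < ε) (n : ℕ) (η : ℝ) :
    alphaSeq ε (n + 1) * etaP ε (n + 1) η =
      (1 + epsSeq ε (n + 1)) * (alphaSeq ε n * etaP ε n η) ^ 2 - epsSeq ε (n + 1) := by
  have h := epsSeq_succ_pos h0 n
  have hα : (1 + epsSeq ε (n + 1)) ≠ 0 := by positivity
  rw [etaP, alphaSeq]
  field_simp

theorem abs_alphaSeq_mul_etaP_zero_le {ε : ℝ} (h0 : 0 < ε) (h1 : ε < 1) (n : ℕ) :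
    |alphaSeq ε (n + 1) * etaP ε (n + 1) 0| ≤ epsSeq ε (n + 1) := by
  have hp := epsSeq_succ_pos h0 n
  induction n with
  | zero =>
    rw [alphaSeq_mul_etaP_succ h0]
    simpa [etaP] using (abs_of_pos hp).le
  | succ n ih =>
    have hsq := sq_le_sq' (abs_le.mp (ih (epsSeq_succ_pos h0 n))).1
      (abs_le.mp (ih (epsSeq_succ_pos h0 n))).2
    rw [← epsSeq_succ_succ] at hsq
    have hlt := epsSeq_succ_lt_one h0 h1 (n + 1)
    rw [alphaSeq_mul_etaP_succ h0, abs_le]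
    have hnn := sq_nonneg (alphaSeq ε (n + 1) * etaP ε (n + 1) 0)
    constructor <;> nlinarith

theorem one_add_alphaSeq_mul_etaP_zero_pos {ε : ℝ} (h0 : 0 < ε) (h1 : ε < 1) (n : ℕ) :
    0 < 1 + alphaSeq ε (n + 1) * etaP ε (n + 1) 0 := by
  linarith [(abs_le.mp (abs_alphaSeq_mul_etaP_zero_le h0 h1 n)).1, epsSeq_succ_lt_one h0 h1 n]

theorem summable_log_one_add_alphaSeq_mul_etaP_zero {ε : ℝ} (h0 : 0 < ε) (h1 : ε < 1) :
    Summable fun n => Real.log (1 + alphaSeq ε (n + 1) * etaP ε (n + 1) 0) :=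
  Real.summable_log_one_add_of_summable
    (Summable.of_norm_bounded (summable_epsSeq_succ h0 h1)
      (abs_alphaSeq_mul_etaP_zero_le h0 h1))

theorem Cprod_pos {ε : ℝ} (h0 : 0 < ε) (h1 : ε < 1) : 0 < Cprod ε := by
  rw [Cprod, ← Real.rexp_tsum_eq_tprod (one_add_alphaSeq_mul_etaP_zero_pos h0 h1)
    (summable_log_one_add_alphaSeq_mul_etaP_zero h0 h1)]
  exact Real.exp_pos _

theorem tendsto_prod_Cprod {ε : ℝ} (h0 : 0 < ε) (h1 : ε < 1) :
    Tendsto (fun N : ℕ => ∏ n ∈ Finset.range N, (1 + alphaSeq ε (n + 1) * etaP ε (n + 1) 0))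
      atTop (𝓝 (Cprod ε)) :=
  (Real.multipliable_of_summable_log (one_add_alphaSeq_mul_etaP_zero_pos h0 h1)
    (summable_log_one_add_alphaSeq_mul_etaP_zero h0 h1)).hasProd.tendsto_prod_nat

/-- The partial products are dominated by the telescoping product `∏ (1 + εₙ)`. -/
theorem prod_mul_one_add_epsSeq_one_le {ε : ℝ} (h0 : 0 < ε) (h1 : ε < 1) (N : ℕ) :
    (∏ n ∈ Finset.range (N + 1), (1 + alphaSeq ε (n + 1) * etaP ε (n + 1) 0)) *
      (1 + epsSeq ε 1) ≤ 1 - epsSeq ε (N + 2) := by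
  induction N with
  | zero =>
    have h := alphaSeq_mul_etaP_succ h0 0 0
    have h2 := epsSeq_succ_succ ε 0
    simp only [etaP, zero_add, mul_zero] at h h2
    simp only [Finset.prod_range_one, zero_add, etaP, h, h2]
    apply le_of_eq
    ring
  | succ N ih =>
    have hpos := one_add_alphaSeq_mul_etaP_zero_pos h0 h1 (N + 1)
    have hle := (abs_le.mp (abs_alphaSeq_mul_etaP_zero_le h0 h1 (N + 1))).2
    have hlt := epsSeq_succ_lt_one h0 h1 (N + 1)
    rw [Finset.prod_range_succ, mul_right_comm]
    calc _ ≤ (1 - epsSeq ε (N + 2)) * (1 + epsSeq ε (N + 2)) :=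
          mul_le_mul ih (by linarith) hpos.le (by linarith)
      _ = 1 - epsSeq ε (N + 1 + 2) := by
          rw [epsSeq_succ_succ ε (N + 1)]
          ring

theorem Cprod_lt_one {ε : ℝ} (h0 : 0 < ε) (h1 : ε < 1) : Cprod ε < 1 := by
  have hlim := ((tendsto_add_atTop_iff_nat 1).mpr (tendsto_prod_Cprod h0 h1)).mul_const
    (1 + epsSeq ε 1)
  have hle : Cprod ε * (1 + epsSeq ε 1) ≤ 1 := le_of_tendsto' hlim fun N =>
    (prod_mul_one_add_epsSeq_one_le h0 h1 N).trans
      (by linarith [epsSeq_succ_pos h0 (N + 1)])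
  nlinarith [mul_pos (Cprod_pos h0 h1) (epsSeq_succ_pos h0 0)]

/-- For each `0 < ε < 1` the product defining `C` converges to a positive limit, and there is
an `ε₀ ∈ (0,1)` such that `C < 1` (in particular `C ≠ 1`) whenever `0 < ε < ε₀`. -/
theorem stmt_8 :
    (∀ ε : ℝ, 0 < ε → ε < 1 →
      0 < Cprod ε ∧
      Tendsto (fun N : ℕ => ∏ n ∈ Finset.range N, (1 + alphaSeq ε (n + 1) * etaP ε (n + 1) 0))
        atTop (𝓝 (Cprod ε))) ∧
    ∃ ε₀ : ℝ, 0 < ε₀ ∧ ε₀ < 1 ∧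
      ∀ ε : ℝ, 0 < ε → ε < ε₀ → Cprod ε < 1 ∧ Cprod ε ≠ 1 := by
  refine ⟨fun ε h0 h1 => ⟨Cprod_pos h0 h1, tendsto_prod_Cprod h0 h1⟩,
    1 / 2, by norm_num, by norm_num, fun ε h0 hε => ?_⟩
  have h := Cprod_lt_one h0 (hε.trans (by norm_num))
  exact ⟨h, h.ne⟩
end

section
/- For 0 < ε < 1/8, the function g satisfies g(0) = 1 and is differentiable at 0 with g'(0) = −1; equivalently, the function t ↦ g(1 − t) takes the value 1 at t = 1 and has derivative 1 there, matching the value and first derivative of the function t ↦ t. -/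
open Filter Topology

/-- `g(η) = C ∏_{n=0}^∞ (1 + αₙ ηₙ'(η))⁻¹`. -/
noncomputable def g (ε : ℝ) (η : ℝ) : ℝ :=
  Cprod ε * ∏' n : ℕ, (1 + alphaSeq ε n * etaP ε n η)⁻¹

/-- The scaled sequence: the factors of the product defining `g` are `(1 + scaledEta ε n η)⁻¹`. -/
noncomputable def scaledEta (ε : ℝ) (n : ℕ) (η : ℝ) : ℝ := alphaSeq ε n * etaP ε n η

/-- The sum of `log (1 + aₙ(η))` over `n ≥ 0`. -/
noncomputable def logSum (ε : ℝ) (η : ℝ) : ℝ := ∑' n : ℕ, Real.log (1 + scaledEta ε n η)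

lemma scaledEta_zero (ε η : ℝ) : scaledEta ε 0 η = η := by
  simp [scaledEta, alphaSeq, epsSeq, etaP]

lemma epsSeq_nonneg {ε : ℝ} (hε : 0 < ε) (n : ℕ) : 0 ≤ epsSeq ε n := by
  unfold epsSeq
  split_ifs <;> positivity

lemma epsSeq_succ_le {ε : ℝ} (hε : 0 < ε) (hε8 : ε < 1 / 8) (n : ℕ) :
    epsSeq ε (n + 1) ≤ 1 / 8 * (1 / 4) ^ (n + 1) := by
  have hpow : n + 2 ≤ 2 ^ (n + 1) := Nat.lt_two_pow_self (n := n + 1)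
  calc epsSeq ε (n + 1) = ε ^ (2 ^ (n + 1)) := by simp [epsSeq]
    _ ≤ ε ^ (n + 2) := pow_le_pow_of_le_one hε.le (by linarith) hpow
    _ = ε * ε ^ (n + 1) := by ring
    _ ≤ 1 / 8 * (1 / 4) ^ (n + 1) := by gcongr; linarith

lemma alphaSeq_pos {ε : ℝ} (hε : 0 < ε) (n : ℕ) : 0 < alphaSeq ε n := by
  have := epsSeq_nonneg hε n
  unfold alphaSeq
  linarith

lemma alphaSeq_succ_le_two {ε : ℝ} (hε : 0 < ε) (hε8 : ε < 1 / 8) (n : ℕ) :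
    alphaSeq ε (n + 1) ≤ 2 := by
  have h := epsSeq_succ_le hε hε8 n
  have h1 : ((1 : ℝ) / 4) ^ (n + 1) ≤ 1 := pow_le_one₀ (by norm_num) (by norm_num)
  unfold alphaSeq
  linarith

lemma scaledEta_succ {ε : ℝ} (hε : 0 < ε) (n : ℕ) (η : ℝ) :
    scaledEta ε (n + 1) η = alphaSeq ε (n + 1) * scaledEta ε n η ^ 2 - epsSeq ε (n + 1) := by
  have h := (alphaSeq_pos hε (n + 1)).ne'
  simp only [scaledEta, etaP]
  field_simp

lemma abs_scaledEta_le {ε η : ℝ} (hε : 0 < ε) (hε8 : ε < 1 / 8) (hη : |η| ≤ 1 / 8) (n : ℕ) :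
    |scaledEta ε n η| ≤ 1 / 8 * (1 / 4) ^ n := by
  induction n with
  | zero => simpa [scaledEta_zero] using hη
  | succ n ih =>
    have hsq : scaledEta ε n η ^ 2 ≤ 1 / 64 * (1 / 4) ^ n := by
      have h1 : ((1 : ℝ) / 4) ^ n ≤ 1 := pow_le_one₀ (by norm_num) (by norm_num)
      have h0 : (0 : ℝ) < (1 / 4) ^ n := by positivity
      rw [← sq_abs]
      nlinarith [abs_nonneg (scaledEta ε n η)]
    have hα := alphaSeq_succ_le_two hε hε8 n
    have hα0 := alphaSeq_pos hε (n + 1)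
    have he := epsSeq_succ_le hε hε8 n
    have he0 := epsSeq_nonneg hε (n + 1)
    have hmul : alphaSeq ε (n + 1) * scaledEta ε n η ^ 2 ≤ 2 * (1 / 64 * (1 / 4) ^ n) := by
      gcongr
    have hmul0 : 0 ≤ alphaSeq ε (n + 1) * scaledEta ε n η ^ 2 := by positivity
    rw [scaledEta_succ hε, abs_le]
    rw [pow_succ] at he ⊢
    constructor <;> linarith

lemma abs_scaledEta_le_eighth {ε η : ℝ} (hε : 0 < ε) (hε8 : ε < 1 / 8) (hη : |η| ≤ 1 / 8)
    (n : ℕ) : |scaledEta ε n η| ≤ 1 / 8 := by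
  have h1 : ((1 : ℝ) / 4) ^ n ≤ 1 := pow_le_one₀ (by norm_num) (by norm_num)
  linarith [abs_scaledEta_le hε hε8 hη n]

lemma abs_scaledEta_succ_sub_le {ε η : ℝ} (hε : 0 < ε) (hε8 : ε < 1 / 8) (hη : |η| ≤ 1 / 8)
    (n : ℕ) : |scaledEta ε (n + 1) η - scaledEta ε (n + 1) 0| ≤ 2 * η ^ 2 * (1 / 2) ^ n := by
  have hα := alphaSeq_succ_le_two hε hε8
  have hα0 := fun n => alphaSeq_pos hε (n + 1)
  induction n with
  | zero =>
    rw [scaledEta_succ hε, scaledEta_succ hε, scaledEta_zero, scaledEta_zero,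
      abs_le]
    constructor <;> nlinarith [hα 0, hα0 0, sq_nonneg η]
  | succ n ih =>
    have hx := abs_scaledEta_le_eighth hε hε8 hη (n + 1)
    have hy := abs_scaledEta_le_eighth hε hε8 (η := 0) (by norm_num) (n + 1)
    rw [scaledEta_succ hε (n + 1) η, scaledEta_succ hε (n + 1) 0]
    set x := scaledEta ε (n + 1) η
    set y := scaledEta ε (n + 1) 0
    calc |alphaSeq ε (n + 1 + 1) * x ^ 2 - epsSeq ε (n + 1 + 1)
          - (alphaSeq ε (n + 1 + 1) * y ^ 2 - epsSeq ε (n + 1 + 1))|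
        = alphaSeq ε (n + 1 + 1) * |x + y| * |x - y| := by
          rw [← abs_of_pos (hα0 (n + 1)), ← abs_mul, ← abs_mul, abs_of_pos (hα0 (n + 1))]
          congr 1
          ring
      _ ≤ 2 * (1 / 4) * (2 * η ^ 2 * (1 / 2) ^ n) := by
          gcongr
          · exact hα (n + 1)
          · linarith [abs_add_le x y]
      _ = 2 * η ^ 2 * (1 / 2) ^ (n + 1) := by ring

lemma abs_log_one_add_sub_le {x y : ℝ} (hx : |x| ≤ 1 / 8) (hy : |y| ≤ 1 / 8) :
    |Real.log (1 + x) - Real.log (1 + y)| ≤ 2 * |x - y| := by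
  have key : ∀ {x y : ℝ}, |x| ≤ 1 / 8 → |y| ≤ 1 / 8 →
      Real.log (1 + x) - Real.log (1 + y) ≤ 2 * |x - y| := by
    intro x y hx hy
    rw [abs_le] at hx hy
    have hx1 : 0 < 1 + x := by linarith
    have hy1 : 0 < 1 + y := by linarith
    rw [← Real.log_div hx1.ne' hy1.ne']
    refine (Real.log_le_sub_one_of_pos (by positivity)).trans ?_
    rw [div_sub_one hy1.ne', div_le_iff₀ hy1]
    nlinarith [le_abs_self (x - y), abs_nonneg (x - y)]
  rw [abs_le]
  constructor
  · have := key hy hx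
    rw [abs_sub_comm] at this
    linarith
  · exact key hx hy

lemma summable_log_one_add_scaledEta {ε η : ℝ} (hε : 0 < ε) (hε8 : ε < 1 / 8)
    (hη : |η| ≤ 1 / 8) : Summable fun n => Real.log (1 + scaledEta ε n η) := by
  refine Real.summable_log_one_add_of_summable (Summable.of_norm_bounded
    (g := fun n : ℕ => 1 / 8 * (1 / 4 : ℝ) ^ n) ?_ (abs_scaledEta_le hε hε8 hη))
  exact (summable_geometric_of_lt_one (by norm_num) (by norm_num)).mul_left _

lemma one_add_scaledEta_pos {ε η : ℝ} (hε : 0 < ε) (hε8 : ε < 1 / 8) (hη : |η| ≤ 1 / 8)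
    (n : ℕ) : 0 < 1 + scaledEta ε n η := by
  linarith [(abs_le.mp (abs_scaledEta_le_eighth hε hε8 hη n)).1]

lemma logSum_eq_log_add {ε η : ℝ} (hε : 0 < ε) (hε8 : ε < 1 / 8) (hη : |η| ≤ 1 / 8) :
    logSum ε η = Real.log (1 + η) + ∑' n, Real.log (1 + scaledEta ε (n + 1) η) := by
  rw [logSum, (summable_log_one_add_scaledEta hε hε8 hη).tsum_eq_zero_add, scaledEta_zero]

lemma g_eq_exp {ε η : ℝ} (hε : 0 < ε) (hε8 : ε < 1 / 8) (hη : |η| ≤ 1 / 8) :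
    g ε η = Real.exp (logSum ε 0 - logSum ε η) := by
  have h0 : |(0 : ℝ)| ≤ 1 / 8 := by norm_num
  have hC : Cprod ε = Real.exp (logSum ε 0) := by
    rw [logSum_eq_log_add hε hε8 h0, add_zero, Real.log_one, zero_add]
    exact (Real.rexp_tsum_eq_tprod (fun n => one_add_scaledEta_pos hε hε8 h0 (n + 1))
      ((summable_nat_add_iff 1).mpr (summable_log_one_add_scaledEta hε hε8 h0))).symm
  have hP : ∏' n : ℕ, (1 + alphaSeq ε n * etaP ε n η)⁻¹ = Real.exp (-logSum ε η) := by
    have hs := (summable_log_one_add_scaledEta hε hε8 hη).neg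
    rw [logSum, ← tsum_neg]
    simp only [← Real.log_inv] at hs ⊢
    exact (Real.rexp_tsum_eq_tprod
      (fun n => inv_pos.mpr (one_add_scaledEta_pos hε hε8 hη n)) hs).symm
  rw [g, hC, hP, ← Real.exp_add, sub_eq_add_neg]

lemma abs_tail_logSum_sub_le {ε η : ℝ} (hε : 0 < ε) (hε8 : ε < 1 / 8) (hη : |η| ≤ 1 / 8) :
    |∑' n, Real.log (1 + scaledEta ε (n + 1) η) - ∑' n, Real.log (1 + scaledEta ε (n + 1) 0)|
      ≤ 8 * η ^ 2 := by
  have h0 : |(0 : ℝ)| ≤ 1 / 8 := by norm_num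
  rw [← ((summable_nat_add_iff 1).mpr (summable_log_one_add_scaledEta hε hε8 hη)).tsum_sub
    ((summable_nat_add_iff 1).mpr (summable_log_one_add_scaledEta hε hε8 h0))]
  have hgeom : HasSum (fun n : ℕ => 4 * η ^ 2 * (1 / 2 : ℝ) ^ n) (8 * η ^ 2) := by
    have h := hasSum_geometric_two.mul_left (4 * η ^ 2)
    rwa [show 4 * η ^ 2 * 2 = 8 * η ^ 2 by ring] at h
  rw [← Real.norm_eq_abs]
  refine tsum_of_norm_bounded hgeom fun n => ?_
  have h1 := abs_log_one_add_sub_le (abs_scaledEta_le_eighth hε hε8 hη (n + 1))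
    (abs_scaledEta_le_eighth hε hε8 h0 (n + 1))
  have h2 := abs_scaledEta_succ_sub_le hε hε8 hη n
  rw [Real.norm_eq_abs]
  linarith

lemma eventually_abs_le_eighth : ∀ᶠ η : ℝ in 𝓝 0, |η| ≤ 1 / 8 := by
  filter_upwards [Metric.closedBall_mem_nhds (0 : ℝ) (by norm_num : (0 : ℝ) < 1 / 8)] with η hη
  simpa using hη

lemma hasDerivAt_tail_logSum {ε : ℝ} (hε : 0 < ε) (hε8 : ε < 1 / 8) :
    HasDerivAt (fun η => ∑' n, Real.log (1 + scaledEta ε (n + 1) η)) 0 0 := by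
  rw [hasDerivAt_iff_isLittleO]
  refine Asymptotics.IsBigO.trans_isLittleO (g := fun η : ℝ => η ^ 2) ?_ ?_
  · refine Asymptotics.IsBigO.of_bound 8 ?_
    filter_upwards [eventually_abs_le_eighth] with η hη
    simpa using abs_tail_logSum_sub_le hε hε8 hη
  · simpa using Asymptotics.isLittleO_pow_id (𝕜 := ℝ) (n := 2) (by norm_num)

lemma hasDerivAt_logSum {ε : ℝ} (hε : 0 < ε) (hε8 : ε < 1 / 8) :
    HasDerivAt (logSum ε) 1 0 := by
  have hlog : HasDerivAt (fun η : ℝ => Real.log (1 + η)) 1 0 := by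
    simpa using ((hasDerivAt_id (0 : ℝ)).const_add 1).log (by norm_num)
  have h := hlog.add (hasDerivAt_tail_logSum hε hε8)
  rw [add_zero] at h
  refine h.congr_of_eventuallyEq ?_
  filter_upwards [eventually_abs_le_eighth] with η hη
  exact logSum_eq_log_add hε hε8 hη

lemma hasDerivAt_g {ε : ℝ} (hε : 0 < ε) (hε8 : ε < 1 / 8) : HasDerivAt (g ε) (-1) 0 := by
  have h := ((hasDerivAt_logSum hε hε8).const_sub (logSum ε 0)).exp
  rw [sub_self, Real.exp_zero, one_mul] at h
  refine h.congr_of_eventuallyEq ?_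
  filter_upwards [eventually_abs_le_eighth] with η hη
  exact g_eq_exp hε hε8 hη

/-- `g(0) = 1` and `g'(0) = -1`; equivalently `t ↦ g(1-t)` has value `1` and derivative `1`
at `t = 1`, matching the value and the first derivative of `t ↦ t` there. -/
theorem stmt_10 (ε : ℝ) (hε : 0 < ε) (hε8 : ε < 1 / 8) :
    g ε 0 = 1 ∧ HasDerivAt (g ε) (-1) 0 ∧
    (fun t : ℝ => g ε (1 - t)) 1 = 1 ∧ HasDerivAt (fun t : ℝ => g ε (1 - t)) 1 1 ∧
    (fun t : ℝ => t) 1 = 1 ∧ HasDerivAt (fun t : ℝ => t) 1 1 := by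
  have h0 : g ε 0 = 1 := by rw [g_eq_exp hε hε8 (by norm_num), sub_self, Real.exp_zero]
  refine ⟨h0, hasDerivAt_g hε hε8, by simpa using h0, ?_, rfl, hasDerivAt_id 1⟩
  have hg : HasDerivAt (g ε) (-1) (1 - 1) := by simpa using hasDerivAt_g hε hε8
  simpa using hg.comp_const_sub 1 1
end
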